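/- Let k be a field of characteristic 2 and let G = ⟨g⟩ be a cyclic group of order 4, so that kG ≅ k[t]/(t⁴) via g ↦ 1 + t. Let A be a finitely generated kG-module equipped with a stable tt-ring structure (μ, u, σ). Then A has no direct summand isomorphic to the 3-dimensional indecomposable kG-module [3] = k[t]/(t³), on which g acts as multiplication by 1 + t. -/

import Mathlib

open TensorProduct

section Defs

variable {k G : Type} [Field k] [Group G]

/-- A `kG`-linear map between two representations of `G` over `k`:
a `k`-linear map commuting with the `G`-actions. -/
def Equivariant {V W : Type} [AddCommGroup V] [Module k V] [AddCommGroup W] [Module k W]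
    (ρV : Representation k G V) (ρW : Representation k G W) (f : V →ₗ[k] W) : Prop :=
  ∀ g : G, f ∘ₗ ρV g = ρW g ∘ₗ f

/-- A `kG`-linear map is stably trivial if it factors through a projective
`kG`-module (equivariantly). -/
def StablyTrivial {V W : Type} [AddCommGroup V] [Module k V] [AddCommGroup W] [Module k W]
    (ρV : Representation k G V) (ρW : Representation k G W) (f : V →ₗ[k] W) : Prop :=
  ∃ (P : Type) (_ : AddCommGroup P) (_ : Module k P) (ρP : Representation k G P),
    Module.Projective (MonoidAlgebra k G) ρP.asModule ∧
    ∃ (a : V →ₗ[k] P) (b : P →ₗ[k] W),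
      Equivariant ρV ρP a ∧ Equivariant ρP ρW b ∧ f = b ∘ₗ a

/-- A `kG`-linear map is a stable isomorphism if it is invertible up to
stably trivial maps. -/
def StableIso {V W : Type} [AddCommGroup V] [Module k V] [AddCommGroup W] [Module k W]
    (ρV : Representation k G V) (ρW : Representation k G W) (f : V →ₗ[k] W) : Prop :=
  Equivariant ρV ρW f ∧ ∃ ψ : W →ₗ[k] V, Equivariant ρW ρV ψ ∧
    StablyTrivial ρV ρV (ψ ∘ₗ f - LinearMap.id) ∧
    StablyTrivial ρW ρW (f ∘ₗ ψ - LinearMap.id)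

/-- A stable tt-ring structure on a `kG`-module `A`: a commutative, separable,
associative and unital multiplication, where all identities hold up to stably
trivial maps (i.e. in the stable module category). -/
structure StableTTRing {A : Type} [AddCommGroup A] [Module k A]
    (ρ : Representation k G A) where
  mul : A ⊗[k] A →ₗ[k] A
  one : k →ₗ[k] A
  sec : A →ₗ[k] A ⊗[k] A
  mul_equivariant : Equivariant (ρ.tprod ρ) ρ mul
  one_equivariant : Equivariant (Representation.trivial k (G := G) (V := k)) ρ one
  sec_equivariant : Equivariant ρ (ρ.tprod ρ) sec
  assoc : StablyTrivial ((ρ.tprod ρ).tprod ρ) ρ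
    (mul ∘ₗ mul.rTensor A -
      mul ∘ₗ mul.lTensor A ∘ₗ (TensorProduct.assoc k A A A).toLinearMap)
  one_mul : StablyTrivial ρ ρ
    (mul ∘ₗ one.rTensor A ∘ₗ (TensorProduct.lid k A).symm.toLinearMap - LinearMap.id)
  mul_one : StablyTrivial ρ ρ
    (mul ∘ₗ one.lTensor A ∘ₗ (TensorProduct.rid k A).symm.toLinearMap - LinearMap.id)
  mul_comm : StablyTrivial (ρ.tprod ρ) ρ
    (mul ∘ₗ (TensorProduct.comm k A A).toLinearMap - mul)
  sep : StablyTrivial ρ ρ (mul ∘ₗ sec - LinearMap.id)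
  sec_left : StablyTrivial (ρ.tprod ρ) (ρ.tprod ρ)
    (mul.rTensor A ∘ₗ (TensorProduct.assoc k A A A).symm.toLinearMap ∘ₗ sec.lTensor A
      - sec ∘ₗ mul)
  sec_right : StablyTrivial (ρ.tprod ρ) (ρ.tprod ρ)
    (mul.lTensor A ∘ₗ (TensorProduct.assoc k A A A).toLinearMap ∘ₗ sec.rTensor A
      - sec ∘ₗ mul)

/-- `ρU` is (isomorphic to) a direct summand of `ρM`, witnessed by an equivariant
split monomorphism. -/
def IsDirectSummandRep {U M : Type} [AddCommGroup U] [Module k U]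
    [AddCommGroup M] [Module k M]
    (ρU : Representation k G U) (ρM : Representation k G M) : Prop :=
  ∃ (i : U →ₗ[k] M) (r : M →ₗ[k] U),
    Equivariant ρU ρM i ∧ Equivariant ρM ρU r ∧ r ∘ₗ i = LinearMap.id

end Defs

theorem exists_averaging_of_projective {k G P : Type} [Field k] [Group G] [Fintype G]
    [AddCommGroup P] [Module k P] (ρ : Representation k G P)
    (h : Module.Projective (MonoidAlgebra k G) ρ.asModule) :
    ∃ θ : P →ₗ[k] P, ∑ g : G, ρ g ∘ₗ θ ∘ₗ ρ g⁻¹ = LinearMap.id := by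
  obtain ⟨s, hs⟩ := Module.projective_def.1 h
  let e := ρ.asModuleEquiv
  let c : MonoidAlgebra k G →ₗ[k] k :=
    { toFun := fun a => a.coeff 1
      map_add' := fun a b => by simp
      map_smul' := fun a b => by simp }
  let θ : P →ₗ[k] P :=
    Finsupp.linearCombination k (fun x => e x) ∘ₗ Finsupp.mapRange.linearMap c ∘ₗ
      s.restrictScalars k ∘ₗ e.symm.toLinearMap
  refine ⟨θ, ?_⟩
  ext p
  have key : ∀ g : G, (ρ g ∘ₗ θ ∘ₗ ρ g⁻¹) p =
      (s (e.symm p)).sum fun x a => a.coeff g • ρ g (e x) := by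
    intro g
    simp only [θ, LinearMap.comp_apply, LinearEquiv.coe_coe, LinearMap.restrictScalars_apply]
    rw [ρ.asModuleEquiv_symm_map_rho, map_smul, Finsupp.linearCombination_apply,
      Finsupp.mapRange.linearMap_apply, Finsupp.sum_mapRange_index (by simp),
      Finsupp.sum_smul_index' (by simp), map_finsuppSum]
    refine Finsupp.sum_congr fun x _ => ?_
    rw [map_smul]
    change (MonoidAlgebra.single g⁻¹ (1 : k) * s (ρ.asModuleEquiv.symm p) x).coeff 1 •
      ρ g (e x) = _
    rw [MonoidAlgebra.coeff_single_mul_apply]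
    simp [e]
  rw [LinearMap.sum_apply, Finset.sum_congr rfl fun g _ => key g]
  simp only [Finsupp.sum]
  rw [Finset.sum_comm]
  conv_rhs => rw [LinearMap.id_apply, ← e.apply_symm_apply p, ← hs (e.symm p),
    Finsupp.linearCombination_apply, Finsupp.sum, map_sum]
  refine Finset.sum_congr rfl fun x _ => ?_
  rw [id, ρ.asModuleEquiv_map_smul, ρ.asAlgebraHom_def, MonoidAlgebra.lift_apply,
    Finsupp.sum_fintype _ _ (by simp), LinearMap.sum_apply]
  rfl

/-- The transfer `∑ hʲ θ g⁻ʲ` of a linear map, for operators `g` and `h` of order dividing four. -/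
def transfer {k V W : Type} [Field k] [AddCommGroup V] [Module k V] [AddCommGroup W] [Module k W]
    (g : V →ₗ[k] V) (h : W →ₗ[k] W) (θ : V →ₗ[k] W) : V →ₗ[k] W :=
  θ + h ∘ₗ θ ∘ₗ g ∘ₗ g ∘ₗ g + h ∘ₗ h ∘ₗ θ ∘ₗ g ∘ₗ g + h ∘ₗ h ∘ₗ h ∘ₗ θ ∘ₗ g

/-- Equality of linear maps modulo transfers. -/
def StablyEq {k V W : Type} [Field k] [AddCommGroup V] [Module k V] [AddCommGroup W] [Module k W]
    (g : V →ₗ[k] V) (h : W →ₗ[k] W) (f f' : V →ₗ[k] W) : Prop :=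
  ∃ θ : V →ₗ[k] W, f = f' + transfer g h θ

section Transfer

variable {k U V W X : Type} [Field k] [AddCommGroup U] [Module k U] [AddCommGroup V] [Module k V]
  [AddCommGroup W] [Module k W] [AddCommGroup X] [Module k X]
  {e : U →ₗ[k] U} {g : V →ₗ[k] V} {h : W →ₗ[k] W} {i : X →ₗ[k] X}

theorem transfer_add (θ θ' : V →ₗ[k] W) :
    transfer g h (θ + θ') = transfer g h θ + transfer g h θ' := by
  ext v; simp [transfer]; abel

theorem transfer_neg (θ : V →ₗ[k] W) : transfer g h (-θ) = -transfer g h θ := by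
  ext v; simp [transfer]; abel

theorem comp_transfer {b : W →ₗ[k] X} (hb : b ∘ₗ h = i ∘ₗ b) (θ : V →ₗ[k] W) :
    b ∘ₗ transfer g h θ = transfer g i (b ∘ₗ θ) := by
  have hb' : ∀ w, b (h w) = i (b w) := LinearMap.congr_fun hb
  ext v; simp [transfer, hb']

theorem transfer_comp {a : U →ₗ[k] V} (ha : a ∘ₗ e = g ∘ₗ a) (θ : V →ₗ[k] W) :
    transfer g h θ ∘ₗ a = transfer e h (θ ∘ₗ a) := by
  have ha' : ∀ u, a (e u) = g (a u) := LinearMap.congr_fun ha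
  ext v; simp [transfer, ha']

theorem rTensor_transfer (hi : ∀ x, i (i (i (i x))) = x) (θ : V →ₗ[k] W) :
    (transfer g h θ).rTensor X =
      transfer (TensorProduct.map g i) (TensorProduct.map h i) (θ.rTensor X) := by
  ext v x; simp [transfer, hi]

theorem lTensor_transfer (hi : ∀ x, i (i (i (i x))) = x) (θ : V →ₗ[k] W) :
    (transfer g h θ).lTensor X =
      transfer (TensorProduct.map i g) (TensorProduct.map i h) (θ.lTensor X) := by
  ext v x; simp [transfer, hi]

namespace StablyEq

theorem refl (f : V →ₗ[k] W) : StablyEq g h f f := ⟨0, by ext; simp [transfer]⟩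

theorem symm {f f' : V →ₗ[k] W} : StablyEq g h f f' → StablyEq g h f' f := by
  rintro ⟨θ, rfl⟩
  exact ⟨-θ, by rw [transfer_neg]; abel⟩

theorem trans {f f' f'' : V →ₗ[k] W} :
    StablyEq g h f f' → StablyEq g h f' f'' → StablyEq g h f f'' := by
  rintro ⟨θ, rfl⟩ ⟨θ', rfl⟩
  exact ⟨θ' + θ, by rw [transfer_add]; abel⟩

theorem comp_left {f f' : V →ₗ[k] W} {b : W →ₗ[k] X} (hb : b ∘ₗ h = i ∘ₗ b) :
    StablyEq g h f f' → StablyEq g i (b ∘ₗ f) (b ∘ₗ f') := by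
  rintro ⟨θ, rfl⟩
  exact ⟨b ∘ₗ θ, by rw [LinearMap.comp_add, comp_transfer hb]⟩

theorem comp_right {f f' : V →ₗ[k] W} {a : U →ₗ[k] V} (ha : a ∘ₗ e = g ∘ₗ a) :
    StablyEq g h f f' → StablyEq e h (f ∘ₗ a) (f' ∘ₗ a) := by
  rintro ⟨θ, rfl⟩
  exact ⟨θ ∘ₗ a, by rw [LinearMap.add_comp, transfer_comp ha]⟩

theorem rTensor (hi : ∀ x, i (i (i (i x))) = x) {f f' : V →ₗ[k] W} :
    StablyEq g h f f' →
      StablyEq (TensorProduct.map g i) (TensorProduct.map h i) (f.rTensor X) (f'.rTensor X) := by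
  rintro ⟨θ, rfl⟩
  exact ⟨θ.rTensor X, by rw [LinearMap.rTensor_add, rTensor_transfer hi]⟩

theorem lTensor (hi : ∀ x, i (i (i (i x))) = x) {f f' : V →ₗ[k] W} :
    StablyEq g h f f' →
      StablyEq (TensorProduct.map i g) (TensorProduct.map i h) (f.lTensor X) (f'.lTensor X) := by
  rintro ⟨θ, rfl⟩
  exact ⟨θ.lTensor X, by rw [LinearMap.lTensor_add, lTensor_transfer hi]⟩

end StablyEq

/-- For the cyclic group of order four, a stably trivial difference is a transfer. -/
theorem StablyTrivial.stablyEq {ρV : Representation k (Multiplicative (ZMod 4)) V}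
    {ρW : Representation k (Multiplicative (ZMod 4)) W} {f f' : V →ₗ[k] W}
    (hf : StablyTrivial ρV ρW (f - f')) :
    StablyEq (ρV (.ofAdd 1)) (ρW (.ofAdd 1)) f f' := by
  obtain ⟨P, _, _, ρP, hP, a, b, ha, hb, hab⟩ := hf
  obtain ⟨θ, hθ⟩ := exists_averaging_of_projective ρP hP
  have hid : transfer (ρP (.ofAdd 1)) (ρP (.ofAdd 1)) θ = LinearMap.id := by
    rw [← hθ, ← Multiplicative.ofAdd.sum_comp]
    have h2 : Multiplicative.ofAdd (2 : ZMod 4) = .ofAdd 1 * .ofAdd 1 := rfl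
    have h3 : Multiplicative.ofAdd (3 : ZMod 4) = .ofAdd 1 * .ofAdd 1 * .ofAdd 1 := rfl
    have i1 : (Multiplicative.ofAdd (1 : ZMod 4))⁻¹ = .ofAdd 3 := rfl
    have i2 : (Multiplicative.ofAdd (2 : ZMod 4))⁻¹ = .ofAdd 2 := rfl
    have i3 : (Multiplicative.ofAdd (3 : ZMod 4))⁻¹ = .ofAdd 1 := rfl
    have hsum := Fin.sum_univ_four
      fun j : ZMod 4 => ρP (.ofAdd j) ∘ₗ θ ∘ₗ ρP (Multiplicative.ofAdd j)⁻¹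
    refine Eq.trans ?_ hsum.symm
    change _ = ρP (.ofAdd (0 : ZMod 4)) ∘ₗ θ ∘ₗ ρP (Multiplicative.ofAdd (0 : ZMod 4))⁻¹ +
      ρP (.ofAdd (1 : ZMod 4)) ∘ₗ θ ∘ₗ ρP (Multiplicative.ofAdd (1 : ZMod 4))⁻¹ +
      ρP (.ofAdd (2 : ZMod 4)) ∘ₗ θ ∘ₗ ρP (Multiplicative.ofAdd (2 : ZMod 4))⁻¹ +
      ρP (.ofAdd (3 : ZMod 4)) ∘ₗ θ ∘ₗ ρP (Multiplicative.ofAdd (3 : ZMod 4))⁻¹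
    rw [i1, i2, i3, h2, h3, ofAdd_zero, inv_one]
    ext v
    simp [transfer]
  refine ⟨b ∘ₗ θ ∘ₗ a, ?_⟩
  rw [← sub_eq_iff_eq_add', hab, ← comp_transfer (hb _), ← transfer_comp (ha _), hid,
    LinearMap.id_comp]

end Transfer

section Symmetry

variable {k A : Type} [Field k] [AddCommGroup A] [Module k A] {g : A →ₗ[k] A}
  {m : A ⊗[k] A →ₗ[k] A} {d : A →ₗ[k] A ⊗[k] A} {u : k →ₗ[k] A}

theorem assoc_symm_equivariant :
    (TensorProduct.assoc k A A A).symm.toLinearMap ∘ₗ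
        TensorProduct.map g (TensorProduct.map g g) =
      TensorProduct.map (TensorProduct.map g g) g ∘ₗ
        (TensorProduct.assoc k A A A).symm.toLinearMap := by
  ext; simp

theorem comm_equivariant {B : Type} [AddCommGroup B] [Module k B] {h : B →ₗ[k] B} :
    (TensorProduct.comm k A B).toLinearMap ∘ₗ TensorProduct.map g h =
      TensorProduct.map h g ∘ₗ (TensorProduct.comm k A B).toLinearMap := by
  ext; simp

theorem rTensor_equivariant {B C D : Type} [AddCommGroup B] [Module k B] {h : B →ₗ[k] B}
    [AddCommGroup C] [Module k C] {i : C →ₗ[k] C} [AddCommGroup D] [Module k D] {e : D →ₗ[k] D}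
    {f : B →ₗ[k] C} (hf : f ∘ₗ h = i ∘ₗ f) :
    f.rTensor D ∘ₗ TensorProduct.map h e = TensorProduct.map i e ∘ₗ f.rTensor D := by
  have hf' : ∀ x, f (h x) = i (f x) := LinearMap.congr_fun hf
  ext; simp [hf']

theorem lTensor_equivariant {B C D : Type} [AddCommGroup B] [Module k B] {h : B →ₗ[k] B}
    [AddCommGroup C] [Module k C] {i : C →ₗ[k] C} [AddCommGroup D] [Module k D] {e : D →ₗ[k] D}
    {f : B →ₗ[k] C} (hf : f ∘ₗ h = i ∘ₗ f) :
    f.lTensor D ∘ₗ TensorProduct.map e h = TensorProduct.map e i ∘ₗ f.lTensor D := by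
  have hf' : ∀ x, f (h x) = i (f x) := LinearMap.congr_fun hf
  ext; simp [hf']

theorem comp_equivariant {B C D : Type} [AddCommGroup B] [Module k B] {h : B →ₗ[k] B}
    [AddCommGroup C] [Module k C] {i : C →ₗ[k] C} [AddCommGroup D] [Module k D] {e : D →ₗ[k] D}
    {f' : C →ₗ[k] D} (hf' : f' ∘ₗ i = e ∘ₗ f') {f : B →ₗ[k] C} (hf : f ∘ₗ h = i ∘ₗ f) :
    (f' ∘ₗ f) ∘ₗ h = e ∘ₗ f' ∘ₗ f := by
  rw [LinearMap.comp_assoc, hf, ← LinearMap.comp_assoc, hf', LinearMap.comp_assoc]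

/-- Expansion of the section in terms of its value at the unit. -/
theorem section_stablyEq (hd : d ∘ₗ g = TensorProduct.map g g ∘ₗ d) (hu : g (u 1) = u 1)
    (hunit : StablyEq g g
      (m ∘ₗ u.lTensor A ∘ₗ (TensorProduct.rid k A).symm.toLinearMap) LinearMap.id)
    (hL : StablyEq (TensorProduct.map g g) (TensorProduct.map g g)
      (m.rTensor A ∘ₗ (TensorProduct.assoc k A A A).symm.toLinearMap ∘ₗ d.lTensor A)
      (d ∘ₗ m)) :
    StablyEq g (TensorProduct.map g g)
      (m.rTensor A ∘ₗ (TensorProduct.assoc k A A A).symm.toLinearMap ∘ₗ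
        (TensorProduct.mk k A (A ⊗[k] A)).flip (d (u 1))) d := by
  have h1 : (TensorProduct.mk k A (A ⊗[k] A)).flip (d (u 1)) =
      d.lTensor A ∘ₗ u.lTensor A ∘ₗ (TensorProduct.rid k A).symm.toLinearMap := by
    ext; simp
  have hJ : (u.lTensor A ∘ₗ (TensorProduct.rid k A).symm.toLinearMap) ∘ₗ g =
      TensorProduct.map g g ∘ₗ u.lTensor A ∘ₗ (TensorProduct.rid k A).symm.toLinearMap := by
    ext; simp [hu]
  rw [h1]
  exact (hL.comp_right hJ).trans (hunit.comp_left hd)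

theorem section_coassoc (hg : ∀ a, g (g (g (g a))) = a)
    (hd : d ∘ₗ g = TensorProduct.map g g ∘ₗ d) (hu : g (u 1) = u 1)
    (hunit : StablyEq g g
      (m ∘ₗ u.lTensor A ∘ₗ (TensorProduct.rid k A).symm.toLinearMap) LinearMap.id)
    (hL : StablyEq (TensorProduct.map g g) (TensorProduct.map g g)
      (m.rTensor A ∘ₗ (TensorProduct.assoc k A A A).symm.toLinearMap ∘ₗ d.lTensor A)
      (d ∘ₗ m))
    (hR : StablyEq (TensorProduct.map g g) (TensorProduct.map g g)
      (m.lTensor A ∘ₗ (TensorProduct.assoc k A A A).toLinearMap ∘ₗ d.rTensor A)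
      (d ∘ₗ m)) :
    StablyEq g (TensorProduct.map (TensorProduct.map g g) g)
      (d.rTensor A ∘ₗ d)
      ((TensorProduct.assoc k A A A).symm.toLinearMap ∘ₗ d.lTensor A ∘ₗ d) := by
  have hE := section_stablyEq hd hu hunit hL
  set J := (TensorProduct.mk k A (A ⊗[k] A)).flip (d (u 1)) with hJ
  have hgu : TensorProduct.map g g (d (u 1)) = d (u 1) := by
    rw [← LinearMap.comp_apply, ← hd, LinearMap.comp_apply, hu]
  have hJg : J ∘ₗ g = TensorProduct.map g (TensorProduct.map g g) ∘ₗ J := by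
    ext; simp [hJ, hgu]
  have hleft := ((hE.symm.lTensor hg).comp_right hd).comp_left assoc_symm_equivariant
  have key : ∀ (t : A ⊗[k] A) (q : A ⊗[k] A),
      (m.lTensor A).rTensor A ((TensorProduct.assoc k A A A).toLinearMap.rTensor A
        ((TensorProduct.assoc k (A ⊗[k] A) A A).symm (q ⊗ₜ t))) =
      (TensorProduct.assoc k A A A).symm ((m.rTensor A ∘ₗ
        (TensorProduct.assoc k A A A).symm.toLinearMap ∘ₗ
        (TensorProduct.mk k A (A ⊗[k] A)).flip t).lTensor A q) := by
    intro t q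
    induction t using TensorProduct.induction_on with
    | zero => simp
    | add x y hx hy =>
      simp only [tmul_add, map_add, LinearMap.comp_add, LinearMap.lTensor_add,
        LinearMap.add_apply, hx, hy]
    | tmul x y =>
      induction q using TensorProduct.induction_on with
      | zero => simp
      | add p q hp hq => simp only [add_tmul, map_add, hp, hq]
      | tmul a b => simp
  have hcomp : ∀ (a : A) (t : A ⊗[k] A), (d.rTensor A).rTensor A
      ((TensorProduct.assoc k A A A).symm (a ⊗ₜ t)) =
      (TensorProduct.assoc k (A ⊗[k] A) A A).symm (d a ⊗ₜ t) := by
    intro a t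
    induction t using TensorProduct.induction_on with
    | zero => simp
    | add x y hx hy => simp only [tmul_add, map_add, hx, hy]
    | tmul x y => simp
  have heq : (m.lTensor A ∘ₗ (TensorProduct.assoc k A A A).toLinearMap ∘ₗ d.rTensor A).rTensor A ∘ₗ
      (TensorProduct.assoc k A A A).symm.toLinearMap ∘ₗ J =
      (TensorProduct.assoc k A A A).symm.toLinearMap ∘ₗ
        (m.rTensor A ∘ₗ (TensorProduct.assoc k A A A).symm.toLinearMap ∘ₗ J).lTensor A ∘ₗ d := by
    refine LinearMap.ext fun a => ?_
    simp only [LinearMap.rTensor_comp, LinearMap.comp_apply, LinearEquiv.coe_coe, hJ,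
      LinearMap.flip_apply, TensorProduct.mk_apply, hcomp]
    exact key _ _
  have hfin : (d ∘ₗ m).rTensor A ∘ₗ (TensorProduct.assoc k A A A).symm.toLinearMap ∘ₗ J =
      d.rTensor A ∘ₗ m.rTensor A ∘ₗ (TensorProduct.assoc k A A A).symm.toLinearMap ∘ₗ J := by
    rw [LinearMap.rTensor_comp, LinearMap.comp_assoc]
  have hright := (hR.rTensor hg).comp_right (comp_equivariant assoc_symm_equivariant hJg)
  rw [hfin, heq] at hright
  exact ((hE.symm.comp_left (rTensor_equivariant (e := g) hd)).trans hright.symm).trans hleft.symm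

theorem section_symm (hg : ∀ a, g (g (g (g a))) = a)
    (hm : m ∘ₗ TensorProduct.map g g = g ∘ₗ m)
    (hd : d ∘ₗ g = TensorProduct.map g g ∘ₗ d) (hu : g (u 1) = u 1)
    (hunit : StablyEq g g
      (m ∘ₗ u.lTensor A ∘ₗ (TensorProduct.rid k A).symm.toLinearMap) LinearMap.id)
    (hcomm : StablyEq (TensorProduct.map g g) g
      (m ∘ₗ (TensorProduct.comm k A A).toLinearMap) m)
    (hsep : StablyEq g g (m ∘ₗ d) LinearMap.id)
    (hL : StablyEq (TensorProduct.map g g) (TensorProduct.map g g)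
      (m.rTensor A ∘ₗ (TensorProduct.assoc k A A A).symm.toLinearMap ∘ₗ d.lTensor A)
      (d ∘ₗ m))
    (hR : StablyEq (TensorProduct.map g g) (TensorProduct.map g g)
      (m.lTensor A ∘ₗ (TensorProduct.assoc k A A A).toLinearMap ∘ₗ d.rTensor A)
      (d ∘ₗ m)) :
    StablyEq g (TensorProduct.map g g) ((TensorProduct.comm k A A).toLinearMap ∘ₗ d) d := by
  have hco := section_coassoc hg hd hu hunit hL hR
  have hτ := comm_equivariant (k := k) (g := g) (h := g)
  have hτd := comp_equivariant hτ hd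
  have h1 : StablyEq g (TensorProduct.map g g)
      (d ∘ₗ m ∘ₗ (TensorProduct.comm k A A).toLinearMap ∘ₗ d) d :=
    (((hcomm.comp_right hd).trans hsep).comp_left hd)
  have hG : (m.rTensor A ∘ₗ (TensorProduct.assoc k A A A).symm.toLinearMap ∘ₗ
        (TensorProduct.comm k (A ⊗[k] A) A).toLinearMap) ∘ₗ
          TensorProduct.map (TensorProduct.map g g) g =
      TensorProduct.map g g ∘ₗ m.rTensor A ∘ₗ (TensorProduct.assoc k A A A).symm.toLinearMap ∘ₗ
        (TensorProduct.comm k (A ⊗[k] A) A).toLinearMap :=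
    comp_equivariant (rTensor_equivariant hm)
      (comp_equivariant assoc_symm_equivariant comm_equivariant)
  have h2 := hL.comp_right hτd
  have h3 := hco.comp_left hG
  have h4 := (hR.comp_right hτd).comp_left hτ
  have e1 : (m.rTensor A ∘ₗ (TensorProduct.assoc k A A A).symm.toLinearMap ∘ₗ d.lTensor A) ∘ₗ
      (TensorProduct.comm k A A).toLinearMap =
      (m.rTensor A ∘ₗ (TensorProduct.assoc k A A A).symm.toLinearMap ∘ₗ
        (TensorProduct.comm k (A ⊗[k] A) A).toLinearMap) ∘ₗ d.rTensor A := by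
    ext; simp
  have e2 : (m.rTensor A ∘ₗ (TensorProduct.assoc k A A A).symm.toLinearMap ∘ₗ
        (TensorProduct.comm k (A ⊗[k] A) A).toLinearMap) ∘ₗ
          (TensorProduct.assoc k A A A).symm.toLinearMap ∘ₗ d.lTensor A =
      (TensorProduct.comm k A A).toLinearMap ∘ₗ
        (m.lTensor A ∘ₗ (TensorProduct.assoc k A A A).toLinearMap ∘ₗ d.rTensor A) ∘ₗ
          (TensorProduct.comm k A A).toLinearMap := by
    have key : (m.rTensor A ∘ₗ (TensorProduct.assoc k A A A).symm.toLinearMap ∘ₗ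
        (TensorProduct.comm k (A ⊗[k] A) A).toLinearMap) ∘ₗ
          (TensorProduct.assoc k A A A).symm.toLinearMap =
        (TensorProduct.comm k A A).toLinearMap ∘ₗ m.lTensor A ∘ₗ
          (TensorProduct.assoc k A A A).toLinearMap ∘ₗ
            (TensorProduct.comm k A (A ⊗[k] A)).toLinearMap := by
      ext; simp
    rw [← LinearMap.comp_assoc, key]
    ext; simp
  have h5 : StablyEq g (TensorProduct.map g g) (d ∘ₗ m ∘ₗ (TensorProduct.comm k A A).toLinearMap ∘ₗ d)
      ((TensorProduct.comm k A A).toLinearMap ∘ₗ d ∘ₗ m ∘ₗ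
        (TensorProduct.comm k A A).toLinearMap ∘ₗ d) := by
    refine h2.symm.trans ?_
    rw [← LinearMap.comp_assoc, e1]
    refine h3.trans ?_
    refine StablyEq.trans ?_ h4
    rw [← LinearMap.comp_assoc d (LinearMap.lTensor A d), ← LinearMap.comp_assoc, e2]
    exact StablyEq.refl _
  exact ((h1.comp_left hτ).symm.trans h5.symm).trans h1

end Symmetry

section CharTwo

variable {k V W : Type} [Field k] [AddCommGroup V] [Module k V] [AddCommGroup W] [Module k W]

theorem add_self_eq_zero_of_charTwo (k : Type) {V : Type} [Field k] [CharP k 2] [AddCommGroup V]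
    [Module k V] (v : V) : v + v = 0 := by
  rw [← two_smul k, CharTwo.two_eq_zero, zero_smul]

theorem exists_generalized_inverse (n : V →ₗ[k] W) :
    ∃ η : W →ₗ[k] V, ∀ v, n (η (n v)) = n v := by
  obtain ⟨s, hs⟩ := n.rangeRestrict.exists_rightInverse_of_surjective n.range_rangeRestrict
  obtain ⟨η, hη⟩ := s.exists_extend
  refine ⟨η, fun v => ?_⟩
  have h1 : η (n v) = s ⟨n v, v, rfl⟩ := LinearMap.congr_fun hη ⟨n v, v, rfl⟩
  have h2 := LinearMap.congr_fun hs ⟨n v, v, rfl⟩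
  rw [h1]
  exact congrArg Subtype.val h2

/-- In characteristic two this is `g² - 1 = (g - 1)²`. -/
def sqSubOne (g : V →ₗ[k] V) : V →ₗ[k] V := g ∘ₗ g + LinearMap.id

/-- In characteristic two this is `(g - 1)³`. -/
def cyclicSum (g : V →ₗ[k] V) : V →ₗ[k] V :=
  LinearMap.id + g + g ∘ₗ g + g ∘ₗ g ∘ₗ g

/-- The trace of an operator commuting with `g` on the image of `(g - 1)²` in characteristic two,
computed through a generalized inverse. -/
noncomputable def sqTrace (g f : V →ₗ[k] V) : k :=
  LinearMap.trace k V (f ∘ₗ sqSubOne g ∘ₗ (exists_generalized_inverse (sqSubOne g)).choose)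

theorem sqTrace_add (g f f' : V →ₗ[k] V) : sqTrace g (f + f') = sqTrace g f + sqTrace g f' := by
  simp [sqTrace, LinearMap.add_comp]

theorem sqTrace_eq_zero_of_comp {g f : V →ₗ[k] V} (hf : f ∘ₗ sqSubOne g = 0) :
    sqTrace g f = 0 := by
  rw [sqTrace, ← LinearMap.comp_assoc, hf]; simp

theorem sqTrace_comp_comm [FiniteDimensional k V] [FiniteDimensional k W]
    {g : V →ₗ[k] V} {h : W →ₗ[k] W} {f : V →ₗ[k] W} {f' : W →ₗ[k] V}
    (hf : f ∘ₗ g = h ∘ₗ f) (hf' : f' ∘ₗ h = g ∘ₗ f') :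
    sqTrace g (f' ∘ₗ f) = sqTrace h (f ∘ₗ f') := by
  have h1 : ∀ v, f (g v) = h (f v) := LinearMap.congr_fun hf
  have h2 : ∀ v, f' (h v) = g (f' v) := LinearMap.congr_fun hf'
  have n1 : ∀ v, f (sqSubOne g v) = sqSubOne h (f v) := by simp [sqSubOne, h1]
  have n2 : ∀ v, f' (sqSubOne h v) = sqSubOne g (f' v) := by simp [sqSubOne, h2]
  unfold sqTrace
  have hη := (exists_generalized_inverse (sqSubOne g)).choose_spec
  have hη' := (exists_generalized_inverse (sqSubOne h)).choose_spec
  set η := (exists_generalized_inverse (sqSubOne g)).choose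
  set η' := (exists_generalized_inverse (sqSubOne h)).choose
  have e1 : (f' ∘ₗ f) ∘ₗ sqSubOne g ∘ₗ η =
      (f' ∘ₗ sqSubOne h ∘ₗ η') ∘ₗ (f ∘ₗ sqSubOne g ∘ₗ η) := by
    ext v; simp [n1, hη']
  have e2 : (f ∘ₗ f') ∘ₗ sqSubOne h ∘ₗ η' =
      (f ∘ₗ sqSubOne g ∘ₗ η) ∘ₗ (f' ∘ₗ sqSubOne h ∘ₗ η') := by
    ext v; simp [n2, hη]
  rw [e1, e2, LinearMap.trace_comp_comm']

theorem transfer_comm {g : V →ₗ[k] V} (hg : ∀ v, g (g (g (g v))) = v) (θ : V →ₗ[k] V) :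
    transfer g g θ ∘ₗ g = g ∘ₗ transfer g g θ := by
  ext v; simp [transfer, hg]; abel

theorem cyclicSum_transfer {g : V →ₗ[k] V} (hg : ∀ v, g (g (g (g v))) = v) (θ : V →ₗ[k] V) :
    cyclicSum g ∘ₗ transfer g g θ = cyclicSum g ∘ₗ θ ∘ₗ cyclicSum g := by
  ext v; simp [transfer, cyclicSum, hg]; abel

section
variable [CharP k 2] {g : V →ₗ[k] V}

theorem sqTrace_transfer [FiniteDimensional k V] (hg : ∀ v, g (g (g (g v))) = v)
    (θ : V →ₗ[k] V) : sqTrace g (transfer g g θ) = 0 := by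
  unfold sqTrace
  have hη := (exists_generalized_inverse (sqSubOne g)).choose_spec
  set η := (exists_generalized_inverse (sqSubOne g)).choose
  have ng : ∀ v, sqSubOne g (g v) = g (sqSubOne g v) := by simp [sqSubOne]
  have gn : ∀ v, g (g (sqSubOne g v)) = sqSubOne g v := by simp [sqSubOne, hg, add_comm]
  have e : transfer g g θ ∘ₗ sqSubOne g ∘ₗ η =
      sqSubOne g ∘ₗ (θ ∘ₗ sqSubOne g ∘ₗ η) + (sqSubOne g ∘ₗ g) ∘ₗ (θ ∘ₗ g ∘ₗ sqSubOne g ∘ₗ η) := by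
    ext v
    simp only [transfer, LinearMap.add_apply, LinearMap.comp_apply, gn]
    simp only [sqSubOne, LinearMap.add_apply, LinearMap.comp_apply, LinearMap.id_apply, map_add]
    abel
  have e1 : (θ ∘ₗ sqSubOne g ∘ₗ η) ∘ₗ sqSubOne g = θ ∘ₗ sqSubOne g := by
    ext v; simp [hη]
  have e2 : (θ ∘ₗ g ∘ₗ sqSubOne g ∘ₗ η) ∘ₗ sqSubOne g ∘ₗ g = θ ∘ₗ sqSubOne g := by
    ext v
    simp only [LinearMap.comp_apply]
    rw [hη, ng, gn]
  rw [e, map_add, LinearMap.trace_comp_comm' (θ ∘ₗ sqSubOne g ∘ₗ η) (sqSubOne g),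
    LinearMap.trace_comp_comm' (θ ∘ₗ g ∘ₗ sqSubOne g ∘ₗ η) (sqSubOne g ∘ₗ g), e1, e2]
  exact CharTwo.add_self_eq_zero _

/-- The identity is a transfer plus a map killed by `(g - 1)³`. -/
theorem exists_transfer_complement (hg : ∀ v, g (g (g (g v))) = v) :
    ∃ θ x : V →ₗ[k] V, (∀ v, x (g v) = g (x v)) ∧ (∀ v, cyclicSum g (x v) = 0) ∧
      LinearMap.id = transfer g g θ + x ∘ₗ x := by
  obtain ⟨θ, hθ⟩ := exists_generalized_inverse (cyclicSum g)
  have two := add_self_eq_zero_of_charTwo k (V := V)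
  have hc : ∀ v, transfer g g θ (g v) = g (transfer g g θ v) :=
    LinearMap.congr_fun (transfer_comm hg θ)
  have hs : ∀ v, cyclicSum g (transfer g g θ v) = cyclicSum g v := fun v =>
    (LinearMap.congr_fun (cyclicSum_transfer hg θ) v).trans (hθ v)
  refine ⟨θ ∘ₗ transfer g g θ, LinearMap.id + transfer g g θ, ?_, ?_, ?_⟩
  · intro v; simp [hc]
  · intro v; simp [hs, two]
  · rw [← transfer_comp (transfer_comm hg θ)]
    ext v
    simp only [LinearMap.add_apply, LinearMap.comp_apply, LinearMap.id_apply, map_add]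
    have := two (transfer g g θ v)
    have h2 := two (transfer g g θ (transfer g g θ v))
    grind

theorem sqTrace_eq_zero [FiniteDimensional k V] (hg : ∀ v, g (g (g (g v))) = v)
    (hV : ∀ w, cyclicSum g w = 0 → ∃ u, sqSubOne g w = cyclicSum g u)
    {f : V →ₗ[k] V} (hf : f ∘ₗ g = g ∘ₗ f) : sqTrace g f = 0 := by
  obtain ⟨θ, x, hxg, hx, hid⟩ := exists_transfer_complement hg
  have hxs : ∀ v, x (sqSubOne g v) = sqSubOne g (x v) := by simp [sqSubOne, hxg]
  have hxc : ∀ v, x (cyclicSum g v) = cyclicSum g (x v) := by simp [cyclicSum, hxg]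
  have h : f = transfer g g (f ∘ₗ θ) + f ∘ₗ x ∘ₗ x := by
    rw [← comp_transfer hf, ← LinearMap.comp_add, ← hid, LinearMap.comp_id]
  rw [h, sqTrace_add, sqTrace_transfer hg, sqTrace_eq_zero_of_comp, add_zero]
  ext w
  obtain ⟨u, hu⟩ := hV (x w) (hx w)
  simp only [LinearMap.comp_apply, hxs]
  rw [← hxs, hu, hxc, hx]
  simp

end

/-- The identity is a transfer, plus a map factoring through a sum of three-dimensional Jordan
blocks, plus a map killed by `(g - 1)²`. -/
theorem exists_jordan_splitting [CharP k 2] {g : V →ₗ[k] V} (hg : ∀ v, g (g (g (g v))) = v) :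
    ∃ θ x ζ T Z X : V →ₗ[k] V, T = LinearMap.id + g ∧
      (∀ v, x (g v) = g (x v)) ∧ (∀ v, T (T (T (x v))) = 0) ∧
      Z = T ∘ₗ T ∘ₗ x ∘ₗ ζ ∘ₗ x + T ∘ₗ x ∘ₗ ζ ∘ₗ x ∘ₗ T + x ∘ₗ ζ ∘ₗ x ∘ₗ T ∘ₗ T ∧
      X ∘ₗ g = g ∘ₗ X ∧ (∀ v, g (g (X v)) = X v) ∧ LinearMap.id = transfer g g θ + Z + X := by
  obtain ⟨θ, x, hxg, hx, hid⟩ := exists_transfer_complement hg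
  obtain ⟨ζ, hζ⟩ := exists_generalized_inverse (sqSubOne g)
  have two := add_self_eq_zero_of_charTwo k (V := V)
  let T : V →ₗ[k] V := LinearMap.id + g
  have hT : ∀ v, T v = v + g v := fun v => rfl
  have hTT : ∀ v, T (T v) = sqSubOne g v := by
    intro v
    have := two (g v)
    simp only [T, sqSubOne, LinearMap.add_apply, LinearMap.comp_apply, LinearMap.id_apply, map_add]
    grind
  have hxT : ∀ v, x (T v) = T (x v) := by simp [hT, hxg]
  have hTTT : ∀ v, T (T (T v)) = cyclicSum g v := by
    intro v
    rw [hTT]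
    simp only [T, sqSubOne, cyclicSum, LinearMap.add_apply, LinearMap.comp_apply,
      LinearMap.id_apply, map_add]
    abel
  have hT3 : ∀ v, T (T (T (x v))) = 0 := fun v => (hTTT _).trans (hx v)
  let Z := T ∘ₗ T ∘ₗ x ∘ₗ ζ ∘ₗ x + T ∘ₗ x ∘ₗ ζ ∘ₗ x ∘ₗ T + x ∘ₗ ζ ∘ₗ x ∘ₗ T ∘ₗ T
  have hZ : ∀ v, Z v = T (T (x (ζ (x v)))) + T (x (ζ (x (T v)))) + x (ζ (x (T (T v)))) :=
    fun v => rfl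
  have hZT : ∀ v, Z (T v) = T (Z v) := by
    intro v
    simp only [hZ, map_add, hT3]
    rw [hxT (T (T v)), hxT (T v), hxT v, hT3]
    simp
  have hgT : ∀ v, g v = T v + v := by
    intro v
    have := two v
    rw [hT]; grind
  have hZg : ∀ v, Z (g v) = g (Z v) := by intro v; rw [hgT, hgT, map_add, hZT]
  have hTTZ : ∀ v, T (T (Z v)) = T (T (x (x v))) := by
    intro v
    simp only [hZ, map_add, hT3, zero_add]
    have h := congrArg x (hζ (x v))
    simp only [← hTT] at h
    simpa only [hxT] using h
  refine ⟨θ, x, ζ, T, Z, x ∘ₗ x + Z, rfl, hxg, hT3, rfl, ?_, ?_, ?_⟩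
  · ext v; simp [hxg, hZg]
  · intro v
    have h1 : sqSubOne g ((x ∘ₗ x + Z) v) = 0 := by
      rw [← hTT]; simp [hTTZ, two]
    have h2 := two ((x ∘ₗ x + Z) v)
    simp only [sqSubOne, LinearMap.add_apply _ LinearMap.id, LinearMap.comp_apply,
      LinearMap.id_apply] at h1
    grind
  · rw [hid]
    ext v
    have := two (Z v)
    simp only [LinearMap.add_apply, LinearMap.comp_apply] at *
    grind

end CharTwo

section JordanBlock

variable {k V : Type} [Field k] [AddCommGroup V] [Module k V]

/-- The tensor product of an operator with a three-dimensional unipotent Jordan block. -/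
def jordanBlock (h : V →ₗ[k] V) : V × V × V →ₗ[k] V × V × V where
  toFun w := (h (w.1 + w.2.1), h (w.2.1 + w.2.2), h w.2.2)
  map_add' v w := by ext <;> simp <;> abel
  map_smul' c v := by ext <;> simp

variable [CharP k 2]

theorem jordanBlock_pow_four {h : V →ₗ[k] V} (hh : ∀ v, h (h (h (h v))) = v) (w : V × V × V) :
    jordanBlock h (jordanBlock h (jordanBlock h (jordanBlock h w))) = w := by
  have two := add_self_eq_zero_of_charTwo k (V := V)
  obtain ⟨x, y, z⟩ := w
  have hy := two y
  have hz := two z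
  ext
  · simp only [jordanBlock, LinearMap.coe_mk, AddHom.coe_mk, map_add, hh]
    grind
  · simp only [jordanBlock, LinearMap.coe_mk, AddHom.coe_mk, map_add, hh]
    grind
  · simp [jordanBlock, hh]

theorem exists_sqSubOne_eq_cyclicSum (w : (V × V × V) × (V × V × V) × (V × V × V))
    (hw : cyclicSum (jordanBlock (jordanBlock (LinearMap.id : V →ₗ[k] V))) w = 0) :
    ∃ u, sqSubOne (jordanBlock (jordanBlock (LinearMap.id : V →ₗ[k] V))) w =
      cyclicSum (jordanBlock (jordanBlock (LinearMap.id : V →ₗ[k] V))) u := by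
  have two := add_self_eq_zero_of_charTwo k (V := V)
  obtain ⟨⟨w00, w01, w02⟩, ⟨w10, w11, w12⟩, ⟨w20, w21, w22⟩⟩ := w
  refine ⟨((0, 0, 0), (0, 0, w20 + w02), (0, 0, w12)), ?_⟩
  simp only [cyclicSum, sqSubOne, jordanBlock, LinearMap.coe_mk, AddHom.coe_mk,
    LinearMap.add_apply, LinearMap.comp_apply, LinearMap.id_apply, Prod.mk_add_mk,
    Prod.mk_eq_zero, Prod.mk.injEq, add_zero, zero_add] at hw ⊢
  have two' : ∀ v w : V, v + (v + w) = w := fun v w => by rw [← add_assoc, two, zero_add]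
  simp only [add_comm, add_left_comm, two, two', add_zero, and_true] at hw ⊢
  obtain ⟨⟨h1, h2⟩, -⟩ := hw
  have h3 : w21 = w12 := by rw [← two' w12 w21, h1, add_zero]
  simp [h2, h3]

/-- Operators that factor through a sum of tensor squares of three-dimensional Jordan blocks have
vanishing trace. -/
theorem sqTrace_comp_norm_eq_zero [FiniteDimensional k V] {a b x Θ g f : V →ₗ[k] V}
    (hab : ∀ v, a (b v) = b (a v)) (hxa : ∀ v, x (a v) = a (x v)) (hxb : ∀ v, x (b v) = b (x v))
    (ha : ∀ v, a (a (a (x v))) = 0) (hb : ∀ v, b (b (b (x v))) = 0)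
    (hg : ∀ v, g v = v + a v + b v + a (b v)) (hf : f ∘ₗ g = g ∘ₗ f) :
    sqTrace g (f ∘ₗ
      (a ∘ₗ a ∘ₗ (b ∘ₗ b ∘ₗ x ∘ₗ Θ ∘ₗ x + b ∘ₗ x ∘ₗ Θ ∘ₗ x ∘ₗ b + x ∘ₗ Θ ∘ₗ x ∘ₗ b ∘ₗ b) +
       a ∘ₗ (b ∘ₗ b ∘ₗ x ∘ₗ Θ ∘ₗ x + b ∘ₗ x ∘ₗ Θ ∘ₗ x ∘ₗ b + x ∘ₗ Θ ∘ₗ x ∘ₗ b ∘ₗ b) ∘ₗ a +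
       (b ∘ₗ b ∘ₗ x ∘ₗ Θ ∘ₗ x + b ∘ₗ x ∘ₗ Θ ∘ₗ x ∘ₗ b + x ∘ₗ Θ ∘ₗ x ∘ₗ b ∘ₗ b) ∘ₗ
         a ∘ₗ a)) = 0 := by
  have hba : ∀ v, b (b (b (a (x v)))) = 0 := fun v => by simp [← hab, hb]
  have hbaa : ∀ v, b (b (b (a (a (x v))))) = 0 := fun v => by simp [← hab, hb]
  let N : V →ₗ[k] V × V × V := LinearMap.prod x (LinearMap.prod (b ∘ₗ x) (b ∘ₗ b ∘ₗ x))
  let α : V →ₗ[k] (V × V × V) × (V × V × V) × (V × V × V) :=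
    LinearMap.prod N (LinearMap.prod (N ∘ₗ a) (N ∘ₗ a ∘ₗ a))
  let M : V × V × V →ₗ[k] V := LinearMap.coprod (b ∘ₗ b ∘ₗ x ∘ₗ Θ)
    (LinearMap.coprod (b ∘ₗ x ∘ₗ Θ) (x ∘ₗ Θ))
  let β : (V × V × V) × (V × V × V) × (V × V × V) →ₗ[k] V :=
    LinearMap.coprod (a ∘ₗ a ∘ₗ M) (LinearMap.coprod (a ∘ₗ M) M)
  let G := jordanBlock (jordanBlock (LinearMap.id : V →ₗ[k] V))
  have hα : α ∘ₗ g = G ∘ₗ α := by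
    refine LinearMap.ext fun v => ?_
    simp only [α, N, G, jordanBlock, LinearMap.comp_apply, LinearMap.prod_apply, Function.prod,
      LinearMap.coe_mk, AddHom.coe_mk, LinearMap.id_apply, hg, map_add, Prod.mk_add_mk,
      Prod.mk.injEq]
    simp only [hxa, hxb, hab, ha, hb, hba, hbaa, map_zero, add_zero, and_true]
    refine ⟨⟨?_, ?_⟩, ?_, ?_⟩ <;> abel
  have hβ : β ∘ₗ G = g ∘ₗ β := by
    refine LinearMap.ext fun ⟨⟨w00, w01, w02⟩, ⟨w10, w11, w12⟩, ⟨w20, w21, w22⟩⟩ => ?_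
    simp only [β, M, G, jordanBlock, LinearMap.comp_apply, LinearMap.coprod_apply,
      LinearMap.coe_mk, AddHom.coe_mk, LinearMap.id_apply, hg, map_add, Prod.mk_add_mk]
    simp only [hab, ha, hb, hba, hbaa, map_zero, add_zero, zero_add]
    abel
  have key := sqTrace_comp_comm (f' := f ∘ₗ β) hα (comp_equivariant hf hβ)
  rw [sqTrace_eq_zero (V := (V × V × V) × (V × V × V) × (V × V × V))
    (jordanBlock_pow_four (jordanBlock_pow_four fun _ => rfl))
    exists_sqSubOne_eq_cyclicSum (comp_equivariant hα (comp_equivariant hf hβ))] at key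
  rw [← key]
  congr 1
  refine LinearMap.ext fun v => ?_
  simp [α, β, N, M, LinearMap.comp_apply, hxa, hxb, hab]
  abel

end JordanBlock

section Separable

variable {k A : Type} [Field k] [AddCommGroup A] [Module k A]
  {g : A →ₗ[k] A} {m : A ⊗[k] A →ₗ[k] A} {d : A →ₗ[k] A ⊗[k] A} {s : A →ₗ[k] A}

theorem map_equivariant {x y : A →ₗ[k] A} (hx : x ∘ₗ g = g ∘ₗ x) (hy : y ∘ₗ g = g ∘ₗ y) :
    TensorProduct.map x y ∘ₗ TensorProduct.map g g =
      TensorProduct.map g g ∘ₗ TensorProduct.map x y := by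
  rw [← TensorProduct.map_comp, ← TensorProduct.map_comp, hx, hy]

variable [CharP k 2]

theorem sqTrace_convolution_of_sq_eq
    (hd : d ∘ₗ g = TensorProduct.map g g ∘ₗ d) {x : A →ₗ[k] A} (hx : x ∘ₗ g = g ∘ₗ x)
    (hgx : ∀ v, g (g (x v)) = x v) :
    sqTrace g (s ∘ₗ m ∘ₗ TensorProduct.map x x ∘ₗ d) = 0 := by
  have hd' : ∀ v, d (g v) = TensorProduct.map g g (d v) := LinearMap.congr_fun hd
  have hx' : ∀ v, x (g v) = g (x v) := LinearMap.congr_fun hx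
  have key : TensorProduct.map x x ∘ₗ TensorProduct.map g g ∘ₗ TensorProduct.map g g =
      TensorProduct.map x x := by
    ext; simp [hx', hgx]
  have key' : ∀ t, TensorProduct.map x x (TensorProduct.map g g (TensorProduct.map g g t)) =
      TensorProduct.map x x t := LinearMap.congr_fun key
  refine sqTrace_eq_zero_of_comp (LinearMap.ext fun v => ?_)
  simp only [sqSubOne, LinearMap.comp_apply, LinearMap.add_apply, LinearMap.id_apply, map_add,
    hd', key', LinearMap.zero_apply]
  exact add_self_eq_zero_of_charTwo k _

variable [FiniteDimensional k A]

theorem StablyEq.sqTrace_eq (hg : ∀ v, g (g (g (g v))) = v) {f f' : A →ₗ[k] A}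
    (h : StablyEq g g f f') : sqTrace g f = sqTrace g f' := by
  obtain ⟨θ, rfl⟩ := h
  rw [sqTrace_add, sqTrace_transfer hg, add_zero]

theorem sqTrace_convolution_comm (hg : ∀ v, g (g (g (g v))) = v)
    (hm : m ∘ₗ TensorProduct.map g g = g ∘ₗ m) (hd : d ∘ₗ g = TensorProduct.map g g ∘ₗ d)
    (hs : s ∘ₗ g = g ∘ₗ s)
    (hcomm : StablyEq (TensorProduct.map g g) g
      (m ∘ₗ (TensorProduct.comm k A A).toLinearMap) m)
    (hsymm : StablyEq g (TensorProduct.map g g) ((TensorProduct.comm k A A).toLinearMap ∘ₗ d) d)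
    {x y : A →ₗ[k] A} (hx : x ∘ₗ g = g ∘ₗ x) (hy : y ∘ₗ g = g ∘ₗ y) :
    sqTrace g (s ∘ₗ m ∘ₗ TensorProduct.map x y ∘ₗ d) =
      sqTrace g (s ∘ₗ m ∘ₗ TensorProduct.map y x ∘ₗ d) := by
  refine StablyEq.sqTrace_eq hg (StablyEq.comp_left hs ?_)
  have h1 := hcomm.comp_right (comp_equivariant (map_equivariant hx hy) hd)
  have h2 := (hsymm.comp_left (map_equivariant hy hx)).comp_left hm
  refine h1.symm.trans (StablyEq.trans ?_ h2)
  have e : (m ∘ₗ (TensorProduct.comm k A A).toLinearMap) ∘ₗ TensorProduct.map x y ∘ₗ d =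
      m ∘ₗ TensorProduct.map y x ∘ₗ (TensorProduct.comm k A A).toLinearMap ∘ₗ d := by
    rw [LinearMap.comp_assoc, ← LinearMap.comp_assoc d (TensorProduct.map x y),
      ← LinearMap.comp_assoc d _ (TensorProduct.map y x)]
    congr 2
    ext; simp
  rw [e]
  exact StablyEq.refl _

theorem sqTrace_transfer_convolution (hg : ∀ v, g (g (g (g v))) = v)
    (hm : m ∘ₗ TensorProduct.map g g = g ∘ₗ m) (hd : d ∘ₗ g = TensorProduct.map g g ∘ₗ d)
    (hs : s ∘ₗ g = g ∘ₗ s) (θ : A →ₗ[k] A) :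
    sqTrace g (s ∘ₗ m ∘ₗ TensorProduct.map (transfer g g θ) (transfer g g θ) ∘ₗ d) = 0 := by
  have e : TensorProduct.map (transfer g g θ) (transfer g g θ) =
      (transfer g g θ).rTensor A ∘ₗ (transfer g g θ).lTensor A := by
    ext; simp
  rw [e, rTensor_transfer hg, LinearMap.comp_assoc,
    transfer_comp (comp_equivariant (lTensor_equivariant (transfer_comm hg θ)) hd),
    comp_transfer hm, comp_transfer hs, sqTrace_transfer hg]

theorem sqTrace_convolution_of_norm (hm : m ∘ₗ TensorProduct.map g g = g ∘ₗ m)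
    (hd : d ∘ₗ g = TensorProduct.map g g ∘ₗ d) (hs : s ∘ₗ g = g ∘ₗ s) {x ζ T Z : A →ₗ[k] A}
    (hT : T = LinearMap.id + g) (hx : ∀ v, x (g v) = g (x v)) (hTx : ∀ v, T (T (T (x v))) = 0)
    (hZ : Z = T ∘ₗ T ∘ₗ x ∘ₗ ζ ∘ₗ x + T ∘ₗ x ∘ₗ ζ ∘ₗ x ∘ₗ T + x ∘ₗ ζ ∘ₗ x ∘ₗ T ∘ₗ T)
    (hZg : Z ∘ₗ g = g ∘ₗ Z) :
    sqTrace g (s ∘ₗ m ∘ₗ TensorProduct.map Z Z ∘ₗ d) = 0 := by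
  have two := add_self_eq_zero_of_charTwo k (V := A)
  have hgT : ∀ v, g v = v + T v := by
    intro v
    have := two v
    rw [hT, LinearMap.add_apply, LinearMap.id_apply]
    grind
  have hxT : ∀ v, x (T v) = T (x v) := by simp [hT, hx]
  have hsm : (s ∘ₗ m ∘ₗ TensorProduct.map Z Z) ∘ₗ TensorProduct.map g g =
      g ∘ₗ s ∘ₗ m ∘ₗ TensorProduct.map Z Z :=
    comp_equivariant hs (comp_equivariant hm (map_equivariant hZg hZg))
  have h := sqTrace_comp_comm hd hsm
  rw [LinearMap.comp_assoc, LinearMap.comp_assoc] at h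
  rw [h]
  have key := sqTrace_comp_norm_eq_zero (a := T.rTensor A) (b := T.lTensor A)
    (x := TensorProduct.map x x) (Θ := TensorProduct.map ζ ζ) (g := TensorProduct.map g g)
    (f := d ∘ₗ s ∘ₗ m)
    (LinearMap.congr_fun (f := T.rTensor A ∘ₗ T.lTensor A) (g := T.lTensor A ∘ₗ T.rTensor A)
      (by ext; simp))
    (LinearMap.congr_fun (f := TensorProduct.map x x ∘ₗ T.rTensor A)
      (g := T.rTensor A ∘ₗ TensorProduct.map x x) (by ext; simp [hxT]))
    (LinearMap.congr_fun (f := TensorProduct.map x x ∘ₗ T.lTensor A)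
      (g := T.lTensor A ∘ₗ TensorProduct.map x x) (by ext; simp [hxT]))
    (LinearMap.congr_fun
      (f := T.rTensor A ∘ₗ T.rTensor A ∘ₗ T.rTensor A ∘ₗ TensorProduct.map x x) (g := 0)
      (by ext; simp [hTx]))
    (LinearMap.congr_fun
      (f := T.lTensor A ∘ₗ T.lTensor A ∘ₗ T.lTensor A ∘ₗ TensorProduct.map x x) (g := 0)
      (by ext; simp [hTx]))
    (LinearMap.congr_fun (f := TensorProduct.map g g)
      (g := LinearMap.id + T.rTensor A + T.lTensor A + T.rTensor A ∘ₗ T.lTensor A)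
      (by ext; simp [hgT, add_tmul, tmul_add]; abel))
    (comp_equivariant hd (comp_equivariant hs hm))
  rw [← key]
  simp only [LinearMap.comp_assoc]
  congr 4
  ext
  simp [hZ, add_tmul, tmul_add]
  abel

/-- Separability forces the trace on the image of `(g - 1)²` to vanish. -/
theorem sqTrace_eq_zero_of_separable (hg : ∀ v, g (g (g (g v))) = v)
    (hm : m ∘ₗ TensorProduct.map g g = g ∘ₗ m) (hd : d ∘ₗ g = TensorProduct.map g g ∘ₗ d)
    (hcomm : StablyEq (TensorProduct.map g g) g
      (m ∘ₗ (TensorProduct.comm k A A).toLinearMap) m)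
    (hsymm : StablyEq g (TensorProduct.map g g) ((TensorProduct.comm k A A).toLinearMap ∘ₗ d) d)
    (hsep : StablyEq g g (m ∘ₗ d) LinearMap.id) (hs : s ∘ₗ g = g ∘ₗ s) :
    sqTrace g s = 0 := by
  obtain ⟨θ, x, ζ, T, Z, X, hT, hxg, hTx, hZ, hX, hgX, hid⟩ := exists_jordan_splitting hg
  have hY := transfer_comm hg θ
  have hZg : Z ∘ₗ g = g ∘ₗ Z := by
    have e : Z = LinearMap.id - transfer g g θ - X := by rw [hid]; abel
    rw [e, LinearMap.sub_comp, LinearMap.sub_comp, LinearMap.comp_sub, LinearMap.comp_sub, hX, hY,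
      LinearMap.id_comp, LinearMap.comp_id]
  have h1 : sqTrace g s = sqTrace g (s ∘ₗ m ∘ₗ TensorProduct.map LinearMap.id LinearMap.id ∘ₗ d) := by
    rw [TensorProduct.map_id, LinearMap.id_comp, (hsep.comp_left hs).sqTrace_eq hg,
      LinearMap.comp_id]
  have hB {x y : A →ₗ[k] A} := sqTrace_convolution_comm hg hm hd hs hcomm hsymm (x := x) (y := y)
  rw [h1, hid]
  simp only [TensorProduct.map_add_left, TensorProduct.map_add_right, LinearMap.add_comp,
    LinearMap.comp_add, sqTrace_add]
  rw [sqTrace_transfer_convolution hg hm hd hs, sqTrace_convolution_of_sq_eq hd hX hgX,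
    sqTrace_convolution_of_norm hm hd hs hT hxg hTx hZ hZg, hB hZg hY, hB hX hY, hB hX hZg]
  linear_combination (sqTrace g (s ∘ₗ m ∘ₗ TensorProduct.map (transfer g g θ) Z ∘ₗ d) +
    sqTrace g (s ∘ₗ m ∘ₗ TensorProduct.map (transfer g g θ) X ∘ₗ d) +
    sqTrace g (s ∘ₗ m ∘ₗ TensorProduct.map Z X ∘ₗ d)) * CharTwo.two_eq_zero (R := k)

end Separable

theorem sqTrace_id_jordanBlock {k : Type} [Field k] [CharP k 2] {g : (Fin 3 → k) →ₗ[k] Fin 3 → k}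
    (hg : ∀ v, g v = ![v 0, v 0 + v 1, v 1 + v 2]) : sqTrace g LinearMap.id = 1 := by
  have hη := (exists_generalized_inverse (sqSubOne g)).choose_spec
  unfold sqTrace
  set η := (exists_generalized_inverse (sqSubOne g)).choose
  have hn : sqSubOne g = LinearMap.single k (fun _ : Fin 3 => k) 2 ∘ₗ LinearMap.proj 0 := by
    have two := add_self_eq_zero_of_charTwo k (V := k)
    refine LinearMap.ext fun v => funext fun i => ?_
    have h0 := two (v 0)
    have h1 := two (v 1)
    have h2 := two (v 2)
    fin_cases i <;> simp [sqSubOne, hg] <;> grind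
  have h1 : LinearMap.proj 0 ∘ₗ η ∘ₗ LinearMap.single k (fun _ : Fin 3 => k) 2 = LinearMap.id := by
    ext
    have := congrFun (hη (Pi.single 0 1)) 2
    simpa [hn] using this
  rw [LinearMap.id_comp, hn, LinearMap.comp_assoc, LinearMap.trace_comp_comm', LinearMap.comp_assoc,
    h1, LinearMap.trace_id]
  simp

/-- Over the cyclic group of order 4 in characteristic 2, a stable tt-ring has no
direct summand isomorphic to the 3-dimensional indecomposable module
`[3] = k[t]/(t³)`, on which the generator acts as multiplication by `1 + t`. -/
theorem stable_tt_ring_over_C4_has_no_three_dimensional_summand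
    (k : Type) [Field k] [CharP k 2]
    (A : Type) [AddCommGroup A] [Module k A] [FiniteDimensional k A]
    (ρ : Representation k (Multiplicative (ZMod 4)) A)
    (T : StableTTRing ρ)
    (ρ₃ : Representation k (Multiplicative (ZMod 4)) (Fin 3 → k))
    (hρ₃ : ∀ v : Fin 3 → k,
      ρ₃ (Multiplicative.ofAdd (1 : ZMod 4)) v = ![v 0, v 0 + v 1, v 1 + v 2]) :
    ¬ IsDirectSummandRep ρ₃ ρ := by
  rintro ⟨i, r, hi, hr, hri⟩
  have hg : ∀ a, ρ (.ofAdd 1) (ρ (.ofAdd 1) (ρ (.ofAdd 1) (ρ (.ofAdd 1) a))) = a := by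
    intro a
    have h : (Multiplicative.ofAdd (1 : ZMod 4)) * (.ofAdd 1 * (.ofAdd 1 * .ofAdd 1)) = 1 := rfl
    simpa only [map_mul, map_one, Module.End.mul_apply, Module.End.one_apply] using
      LinearMap.congr_fun (congrArg ρ h) a
  have hu : ρ (.ofAdd 1) (T.one 1) = T.one 1 :=
    (LinearMap.congr_fun (T.one_equivariant (.ofAdd 1)) 1).symm
  have hsymm := section_symm hg (T.mul_equivariant _) (T.sec_equivariant _) hu
    T.mul_one.stablyEq T.mul_comm.stablyEq T.sep.stablyEq T.sec_left.stablyEq T.sec_right.stablyEq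
  have h0 := sqTrace_eq_zero_of_separable hg (T.mul_equivariant _) (T.sec_equivariant _)
    T.mul_comm.stablyEq hsymm T.sep.stablyEq (comp_equivariant (hi _) (hr _))
  rw [sqTrace_comp_comm (hr _) (hi _), hri, sqTrace_id_jordanBlock hρ₃] at h0
  exact one_ne_zero h0
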